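/- There exists a full density subset S ⊆ 𝒩 such that for every m ∈ S and every n ∈ 𝒩 with (log n)^{1/2}·log log n ≤ r₂(n) ≤ (log n)², the number of elements of 𝒩 lying strictly between m and n is at least r₂(n) / ((log n)^{1/2}·(log log n)·(log r₂(n))²). -/

import Mathlib

open Filter Topology

noncomputable section

/-- The set of natural numbers expressible as a sum of two squares. -/
def SOS : Set ℕ := {n | ∃ x y : ℤ, (n : ℤ) = x ^ 2 + y ^ 2}

/-- `r₂(n)`, the number of representations of `n` as a sum of two squares. -/
def r2 (n : ℕ) : ℕ := Nat.card {p : ℤ × ℤ // p.1 ^ 2 + p.2 ^ 2 = (n : ℤ)}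

/-- A subset `S ⊆ 𝒩` has full density in `𝒩`. -/
def FullDensityIn (S : Set ℕ) : Prop :=
  S ⊆ SOS ∧ Tendsto (fun x : ℕ =>
    (Nat.card {m : ℕ // m ∈ S ∧ m ≤ x} : ℝ) / (Nat.card {m : ℕ // m ∈ SOS ∧ m ≤ x} : ℝ))
    atTop (𝓝 1)

/-- The number of elements of `𝒩` lying strictly between `m` and `n`. -/
def betweenCount (m n : ℕ) : ℕ :=
  Nat.card {k : ℕ // k ∈ SOS ∧ min m n < k ∧ k < max m n}

section SumsOfTwoSquares

open ArithmeticFunction Finset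
open scoped ArithmeticFunction.zeta

lemma sum_Ioc_zero_succ {M : Type*} [AddCommMonoid M] (f : ℕ → M) (k : ℕ) :
    ∑ n ∈ Ioc 0 (k + 1), f n = f (k + 1) + ∑ n ∈ Ioc 0 k, f n := by
  rw [← insert_Ioc_right_eq_Ioc_add_one (Nat.zero_le k), sum_insert (by simp)]

/-- The nontrivial character modulo `4`, as a real arithmetic function. -/
def chiFour : ArithmeticFunction ℝ :=
  ⟨fun n => if n % 2 = 0 then 0 else if n % 4 = 1 then 1 else -1, by simp⟩

lemma chiFour_apply (n : ℕ) :
    chiFour n = if n % 2 = 0 then 0 else if n % 4 = 1 then 1 else -1 := rfl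

lemma chiFour_eq_cast (n : ℕ) : chiFour n = ((ZMod.χ₄ n : ℤ) : ℝ) := by
  rw [ZMod.χ₄_nat_eq_if_mod_four, chiFour_apply]
  push_cast
  rfl

lemma chiFour_mul (m n : ℕ) : chiFour (m * n) = chiFour m * chiFour n := by
  simp only [chiFour_eq_cast, Nat.cast_mul, map_mul, Int.cast_mul]

lemma chiFour_pow (m k : ℕ) : chiFour (m ^ k) = chiFour m ^ k := by
  simp only [chiFour_eq_cast, Nat.cast_pow, map_pow, Int.cast_pow]

lemma isMultiplicative_chiFour : chiFour.IsMultiplicative :=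
  ⟨by simp [chiFour_apply], fun _ => chiFour_mul _ _⟩

lemma sum_chiFour (N : ℕ) :
    ∑ m ∈ Ioc 0 N, chiFour m = if N % 4 = 1 ∨ N % 4 = 2 then 1 else 0 := by
  induction N with
  | zero => simp
  | succ k ih =>
    rw [sum_Ioc_zero_succ, ih, chiFour_apply]
    have : k % 4 = 0 ∨ k % 4 = 1 ∨ k % 4 = 2 ∨ k % 4 = 3 := by omega
    rcases this with h | h | h | h
    · have h1 : (k + 1) % 4 = 1 := by omega
      have h2 : (k + 1) % 2 = 1 := by omega
      simp [h, h1, h2]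
    · have h1 : (k + 1) % 4 = 2 := by omega
      have h2 : (k + 1) % 2 = 0 := by omega
      simp [h, h1, h2]
    · have h1 : (k + 1) % 4 = 3 := by omega
      have h2 : (k + 1) % 2 = 1 := by omega
      simp [h, h1, h2]
    · have h1 : (k + 1) % 4 = 0 := by omega
      have h2 : (k + 1) % 2 = 0 := by omega
      simp [h, h1, h2]

lemma sum_chiFour_range (g : ℕ → ℝ) (K : ℕ) :
    ∑ d ∈ range (4 * K), chiFour d * g d =
      ∑ j ∈ range K, (g (4 * j + 1) - g (4 * j + 3)) := by
  induction K with
  | zero => simp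
  | succ k ih =>
    rw [show 4 * (k + 1) = 4 * k + 1 + 1 + 1 + 1 by ring, sum_range_succ, sum_range_succ,
      sum_range_succ, sum_range_succ, ih, sum_range_succ]
    have h0 : chiFour (4 * k) = 0 := by rw [chiFour_apply, if_pos (by omega)]
    have h1 : chiFour (4 * k + 1) = 1 := by
      rw [chiFour_apply, if_neg (by omega), if_pos (by omega)]
    have h2 : chiFour (4 * k + 1 + 1) = 0 := by rw [chiFour_apply, if_pos (by omega)]
    have h3 : chiFour (4 * k + 1 + 1 + 1) = -1 := by
      rw [chiFour_apply, if_neg (by omega), if_neg (by omega)]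
    rw [h0, h1, h2, h3]
    ring

lemma neg_log_le_sum_chiFour_mul_log (N : ℕ) :
    -Real.log N ≤ ∑ n ∈ Ioc 0 N, chiFour n * Real.log n := by
  have key : ∀ k : ℕ, 0 ≤ ∑ n ∈ Ioc 0 (4 * k + 1), chiFour n * Real.log n := by
    intro k
    induction k with
    | zero => simp
    | succ k ih =>
      have h2 : chiFour (4 * k + 1 + 1) = 0 := by rw [chiFour_apply, if_pos (by omega)]
      have h3 : chiFour (4 * k + 1 + 1 + 1) = -1 := by
        rw [chiFour_apply, if_neg (by omega), if_neg (by omega)]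
      have h4 : chiFour (4 * k + 1 + 1 + 1 + 1) = 0 := by
        rw [chiFour_apply, if_pos (by omega)]
      have h5 : chiFour (4 * k + 1 + 1 + 1 + 1 + 1) = 1 := by
        rw [chiFour_apply, if_neg (by omega), if_pos (by omega)]
      rw [show 4 * (k + 1) + 1 = 4 * k + 1 + 1 + 1 + 1 + 1 by ring]
      iterate 4 rw [sum_Ioc_zero_succ]
      rw [h2, h3, h4, h5]
      have : Real.log ((4 * k + 1 + 1 + 1 : ℕ) : ℝ) ≤
          Real.log ((4 * k + 1 + 1 + 1 + 1 + 1 : ℕ) : ℝ) :=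
        Real.log_le_log (by positivity) (by push_cast; linarith)
      linarith
  obtain rfl | hN := Nat.eq_zero_or_pos N
  · simp
  have hlog : 0 ≤ Real.log N := Real.log_natCast_nonneg N
  obtain ⟨k, hk⟩ : ∃ k, N = 4 * k + 1 ∨ N = 4 * k + 1 + 1 ∨ N = 4 * k + 1 + 1 + 1 ∨
      N = 4 * k + 1 + 1 + 1 + 1 := ⟨(N - 1) / 4, by omega⟩
  have h2 : chiFour (4 * k + 1 + 1) = 0 := by rw [chiFour_apply, if_pos (by omega)]
  have h3 : chiFour (4 * k + 1 + 1 + 1) = -1 := by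
    rw [chiFour_apply, if_neg (by omega), if_neg (by omega)]
  have h4 : chiFour (4 * k + 1 + 1 + 1 + 1) = 0 := by
    rw [chiFour_apply, if_pos (by omega)]
  have := key k
  rcases hk with hk | hk | hk | hk
  · rw [hk] at hlog ⊢
    linarith
  · rw [hk] at hlog ⊢
    rw [sum_Ioc_zero_succ, h2]
    linarith
  · rw [hk]
    iterate 2 rw [sum_Ioc_zero_succ]
    rw [h2, h3]
    linarith
  · rw [hk]
    iterate 3 rw [sum_Ioc_zero_succ]
    rw [h2, h3, h4]
    have : Real.log ((4 * k + 1 + 1 + 1 : ℕ) : ℝ) ≤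
          Real.log ((4 * k + 1 + 1 + 1 + 1 : ℕ) : ℝ) :=
        Real.log_le_log (by positivity) (by push_cast; linarith)
    linarith

/-- The von Mangoldt function restricted to the residue class `1` modulo `4`. -/
def vonMangoldtOne : ArithmeticFunction ℝ := ⟨fun n => if n % 4 = 1 then Λ n else 0, by simp⟩

lemma vonMangoldtOne_apply (n : ℕ) : vonMangoldtOne n = if n % 4 = 1 then Λ n else 0 := rfl

lemma sum_chiFour_mul_log (N : ℕ) :
    ∑ n ∈ Ioc 0 N, chiFour n * Real.log n =
      ∑ d ∈ Ioc 0 N, chiFour d * Λ d * if N / d % 4 = 1 ∨ N / d % 4 = 2 then 1 else 0 := by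
  simp_rw [← sum_chiFour]
  have h := sum_Ioc_mul_eq_sum_sum (chiFour.pmul Λ) chiFour N
  simp only [pmul_apply] at h
  rw [← h]
  refine sum_congr rfl fun n hn => ?_
  have hn0 : n ≠ 0 := by simp at hn; omega
  rw [mul_apply, ← vonMangoldt_sum, mul_sum,
    ← Nat.sum_divisorsAntidiagonal (fun i _ => chiFour n * Λ i)]
  refine sum_congr rfl fun x hx => ?_
  rw [← (Nat.mem_divisorsAntidiagonal.1 hx).1, chiFour_mul]
  simp only [pmul_apply]
  ring

lemma sum_even_vonMangoldt_le (N : ℕ) :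
    ∑ d ∈ Ioc 0 N with d % 2 = 0, Λ d ≤ Real.log N := by
  obtain rfl | hN := Nat.eq_zero_or_pos N
  · simp
  calc ∑ d ∈ Ioc 0 N with d % 2 = 0, Λ d
      ≤ ∑ d ∈ (Ioc 0 (Nat.log 2 N)).image (2 ^ ·), Λ d := by
        rw [← sum_filter_ne_zero]
        refine sum_le_sum_of_subset_of_nonneg ?_ fun _ _ _ => vonMangoldt_nonneg
        intro d hd
        simp only [mem_filter, mem_Ioc, ne_eq, vonMangoldt_eq_zero_iff, not_not] at hd
        obtain ⟨⟨⟨hd0, hdN⟩, hd2⟩, hpp⟩ := hd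
        obtain ⟨p, k, hp, hk, rfl⟩ := (isPrimePow_nat_iff _).1 hpp
        have : 2 ∣ p := Nat.Prime.dvd_of_dvd_pow Nat.prime_two (Nat.dvd_of_mod_eq_zero hd2)
        have hp2 : 2 = p := (Nat.prime_dvd_prime_iff_eq Nat.prime_two hp).1 this
        subst hp2
        exact mem_image.2 ⟨k, mem_Ioc.2 ⟨hk, Nat.le_log_of_pow_le (by norm_num) hdN⟩, rfl⟩
    _ = Nat.log 2 N * Real.log 2 := by
        rw [sum_image (fun a _ b _ h => Nat.pow_right_injective le_rfl h)]
        rw [sum_congr rfl (g := fun _ => Real.log 2)]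
        · simp
        · intro k hk
          rw [vonMangoldt_apply_pow (by rw [mem_Ioc] at hk; omega),
            vonMangoldt_apply_prime Nat.prime_two]
          simp
    _ = Real.log ((2 ^ Nat.log 2 N : ℕ) : ℝ) := by simp
    _ ≤ Real.log N := Real.log_le_log (by positivity)
        (by exact_mod_cast Nat.pow_log_le_self 2 hN.ne')

lemma two_mul_sum_vonMangoldtOne_ge (N : ℕ) :
    Chebyshev.psi N - Chebyshev.psi ((N / 3 : ℕ) : ℝ) - 2 * Real.log N ≤
      2 * ∑ d ∈ Ioc 0 N, vonMangoldtOne d := by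
  have h1 := neg_log_le_sum_chiFour_mul_log N
  have h2 := sum_even_vonMangoldt_le N
  rw [sum_chiFour_mul_log] at h1
  rw [sum_filter] at h2
  have h3 : Chebyshev.psi N - Chebyshev.psi ((N / 3 : ℕ) : ℝ) =
      ∑ d ∈ Ioc 0 N, if N / 3 < d then Λ d else 0 := by
    rw [Chebyshev.psi, Chebyshev.psi, Nat.floor_natCast, Nat.floor_natCast, ← sum_filter,
      sub_eq_iff_eq_add, add_comm,
      ← sum_filter_add_sum_filter_not (Ioc 0 N) (fun d => d ≤ N / 3)]
    simp only [not_le]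
    congr 2
    ext d
    simp only [mem_Ioc, mem_filter]
    omega
  have h4 : (∑ d ∈ Ioc 0 N, if N / 3 < d then Λ d else 0) +
      ∑ d ∈ Ioc 0 N, chiFour d * Λ d * (if N / d % 4 = 1 ∨ N / d % 4 = 2 then 1 else 0) ≤
      2 * (∑ d ∈ Ioc 0 N, vonMangoldtOne d) + ∑ d ∈ Ioc 0 N, if d % 2 = 0 then Λ d else 0 := by
    rw [mul_sum, ← sum_add_distrib, ← sum_add_distrib]
    refine sum_le_sum fun d hd => ?_
    rw [mem_Ioc] at hd
    have hL : 0 ≤ Λ d := vonMangoldt_nonneg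
    rw [vonMangoldtOne_apply, chiFour_apply]
    have h : N / 3 < d → N / d % 4 = 1 ∨ N / d % 4 = 2 := by
      intro h
      have : N / d < 3 := by rw [Nat.div_lt_iff_lt_mul hd.1]; omega
      have : 0 < N / d := Nat.div_pos hd.2 hd.1
      omega
    by_cases hc : N / 3 < d
    · have := h hc
      split_ifs <;> first | omega | linarith
    · split_ifs <;> first | omega | linarith
  linarith

lemma exists_sum_vonMangoldtOne_ge :
    ∃ C : ℝ, ∀ N : ℕ, (N : ℝ) / 20 - C ≤ ∑ d ∈ Ioc 0 N, vonMangoldtOne d := by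
  have hnn : ∀ N : ℕ, 0 ≤ ∑ d ∈ Ioc 0 N, vonMangoldtOne d := fun N =>
    sum_nonneg fun d _ => by rw [vonMangoldtOne_apply]; split_ifs <;> simp
  have hev : ∀ᶠ x : ℝ in atTop, Real.log x ≤ 1 / 100 * √x := by
    have := (isLittleO_log_rpow_atTop (r := 1 / 2) (by norm_num)).bound
      (c := 1 / 100) (by norm_num)
    filter_upwards [this, eventually_ge_atTop 1] with x hx h1
    rw [Real.norm_of_nonneg (Real.log_nonneg h1), Real.norm_of_nonneg (by positivity),
      ← Real.sqrt_eq_rpow] at hx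
    exact hx
  obtain ⟨N0, hN0⟩ := eventually_atTop.1 (tendsto_natCast_atTop_atTop.eventually hev)
  refine ⟨N0 + 3, fun N => ?_⟩
  rcases lt_or_ge N (N0 + 3) with hN | hN
  · refine le_trans ?_ (hnn N)
    have : (N : ℝ) ≤ N0 + 3 := by exact_mod_cast hN.le
    have : (0 : ℝ) ≤ N := by positivity
    linarith
  have hl := hN0 N (by omega)
  have h1 := two_mul_sum_vonMangoldtOne_ge N
  have h2 := Chebyshev.psi_ge N
  have hk : 1 ≤ N / 3 := by omega
  have h3 := Chebyshev.psi_le (x := ((N / 3 : ℕ) : ℝ)) (by exact_mod_cast hk)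
  have hk3 : ((N / 3 : ℕ) : ℝ) ≤ N / 3 := Nat.cast_div_le
  have hN1 : (1 : ℝ) ≤ N := by exact_mod_cast (by omega : 1 ≤ N)
  have hkN : ((N / 3 : ℕ) : ℝ) ≤ N := by linarith
  have hk0 : (1 : ℝ) ≤ ((N / 3 : ℕ) : ℝ) := by exact_mod_cast hk
  have hs : √((N / 3 : ℕ) : ℝ) ≤ √(N : ℝ) := Real.sqrt_le_sqrt hkN
  have hlk : Real.log ((N / 3 : ℕ) : ℝ) ≤ 1 / 100 * √N :=
    (Real.log_le_log (by linarith) hkN).trans hl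
  have hl1 : Real.log (N + 1) ≤ Real.log N + Real.log 2 := by
    rw [← Real.log_mul (by positivity) (by positivity)]
    exact Real.log_le_log (by positivity) (by linarith)
  have hsq : √(N : ℝ) * √N = N := Real.mul_self_sqrt (by positivity)
  have hs1 : √(N : ℝ) ≤ N := by
    rw [Real.sqrt_le_left (by positivity)]
    nlinarith
  have h4 : 2 * √((N / 3 : ℕ) : ℝ) * Real.log ((N / 3 : ℕ) : ℝ) ≤ 2 / 100 * N := by
    calc _ ≤ 2 * √(N : ℝ) * (1 / 100 * √N) := by
          gcongr
      _ = 2 / 100 * N := by linear_combination 2 / 100 * hsq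
  have hlog4 : Real.log 4 = 2 * Real.log 2 := by
    rw [show (4 : ℝ) = 2 ^ 2 by norm_num, Real.log_pow]; norm_num
  rw [hlog4] at h3
  have ha := Real.log_two_gt_d9
  have hb := Real.log_two_lt_d9
  have h5 : 2 * Real.log 2 * ((N / 3 : ℕ) : ℝ) ≤ 2 * Real.log 2 * (N / 3) := by gcongr
  have h6 : 0.6931471803 * (N : ℝ) ≤ Real.log 2 * N := by gcongr
  have : (0 : ℝ) ≤ N0 := by positivity
  nlinarith

lemma zero_mem_SOS : 0 ∈ SOS := ⟨0, 0, by simp⟩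

lemma one_mem_SOS : 1 ∈ SOS := ⟨1, 0, by simp⟩

lemma sq_mem_SOS (k : ℕ) : k ^ 2 ∈ SOS := ⟨k, 0, by push_cast; ring⟩

lemma mul_mem_SOS {m n : ℕ} (hm : m ∈ SOS) (hn : n ∈ SOS) : m * n ∈ SOS := by
  obtain ⟨a, b, hab⟩ := hm
  obtain ⟨c, d, hcd⟩ := hn
  exact ⟨a * c - b * d, a * d + b * c, by push_cast; rw [hab, hcd]; ring⟩

lemma pow_mem_SOS {m : ℕ} (hm : m ∈ SOS) (k : ℕ) : m ^ k ∈ SOS := by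
  induction k with
  | zero => simpa using one_mem_SOS
  | succ k ih => rw [pow_succ]; exact mul_mem_SOS ih hm

lemma mem_SOS_iff_exists_nat {n : ℕ} : n ∈ SOS ↔ ∃ x y : ℕ, n = x ^ 2 + y ^ 2 := by
  constructor
  · rintro ⟨x, y, h⟩
    refine ⟨x.natAbs, y.natAbs, ?_⟩
    zify
    simpa using h
  · rintro ⟨x, y, h⟩
    exact ⟨x, y, by exact_mod_cast h⟩

lemma prime_mem_SOS {p : ℕ} (hp : p.Prime) (h : p % 4 ≠ 3) : p ∈ SOS := by
  have := Fact.mk hp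
  obtain ⟨a, b, hab⟩ := Nat.Prime.sq_add_sq h
  exact mem_SOS_iff_exists_nat.2 ⟨a, b, hab.symm⟩

lemma mem_SOS_iff_even_padicValNat {n : ℕ} :
    n ∈ SOS ↔ ∀ q : ℕ, q.Prime → q % 4 = 3 → Even (padicValNat q n) := by
  rw [mem_SOS_iff_exists_nat, Nat.eq_sq_add_sq_iff]
  refine ⟨fun h q hq hq4 => ?_, fun h q hq => h q (Nat.prime_of_mem_primeFactors hq)⟩
  by_cases hqn : q ∈ n.primeFactors
  · exact h q hqn hq4
  · have : padicValNat q n = 0 := by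
      rw [← Nat.factorization_def n hq]
      exact Finsupp.notMem_support_iff.1 hqn
    simp [this]

lemma mul_mem_SOS_iff_of_coprime {m n : ℕ} (hm : m ≠ 0) (hn : n ≠ 0) (h : m.Coprime n) :
    m * n ∈ SOS ↔ m ∈ SOS ∧ n ∈ SOS := by
  refine ⟨fun hmn => ?_, fun hmn => mul_mem_SOS hmn.1 hmn.2⟩
  rw [mem_SOS_iff_even_padicValNat] at hmn
  have key : ∀ q : ℕ, q.Prime → q % 4 = 3 →
      Even (padicValNat q m) ∧ Even (padicValNat q n) := by
    intro q hq hq4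
    have := Fact.mk hq
    have := hmn q hq hq4
    rw [padicValNat.mul hm hn] at this
    by_cases hqm : q ∣ m
    · have hqn : padicValNat q n = 0 := padicValNat.eq_zero_of_not_dvd fun hqn =>
        Nat.not_coprime_of_dvd_of_dvd hq.one_lt hqm hqn h
      rw [hqn] at this ⊢
      exact ⟨this, Even.zero⟩
    · rw [padicValNat.eq_zero_of_not_dvd hqm] at this ⊢
      exact ⟨Even.zero, by simpa using this⟩
  exact ⟨mem_SOS_iff_even_padicValNat.2 fun q hq h4 => (key q hq h4).1,
    mem_SOS_iff_even_padicValNat.2 fun q hq h4 => (key q hq h4).2⟩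

lemma isPrimePow_mem_SOS {n : ℕ} (hn : IsPrimePow n) (h : n % 4 = 1) : n ∈ SOS := by
  obtain ⟨p, k, hp, -, rfl⟩ := (isPrimePow_nat_iff _).1 hn
  by_cases hp4 : p % 4 = 3
  · rcases Nat.even_or_odd k with ⟨j, rfl⟩ | ⟨j, rfl⟩
    · rw [← two_mul, pow_mul']
      exact sq_mem_SOS _
    · rw [pow_succ, pow_mul, Nat.mul_mod, Nat.pow_mod, Nat.pow_mod p 2, hp4] at h
      norm_num at h
  · exact pow_mem_SOS (prime_mem_SOS hp hp4) k

open Classical in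
/-- The indicator function of the positive sums of two squares. -/
def sosIndicator : ArithmeticFunction ℝ := ⟨fun n => if n ≠ 0 ∧ n ∈ SOS then 1 else 0, by simp⟩

open Classical in
lemma sosIndicator_apply (n : ℕ) :
    sosIndicator n = if n ≠ 0 ∧ n ∈ SOS then 1 else 0 := rfl

lemma sosIndicator_of_mem {n : ℕ} (h0 : n ≠ 0) (h : n ∈ SOS) : sosIndicator n = 1 := by
  rw [sosIndicator_apply, if_pos ⟨h0, h⟩]

lemma sosIndicator_nonneg (n : ℕ) : 0 ≤ sosIndicator n := by
  rw [sosIndicator_apply]; split_ifs <;> simp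

lemma sosIndicator_mul_le (m n : ℕ) :
    sosIndicator m * sosIndicator n ≤ sosIndicator (m * n) := by
  by_cases hm : m ≠ 0 ∧ m ∈ SOS
  · by_cases hn : n ≠ 0 ∧ n ∈ SOS
    · rw [sosIndicator_of_mem (mul_ne_zero hm.1 hn.1) (mul_mem_SOS hm.2 hn.2),
        sosIndicator_of_mem hm.1 hm.2, sosIndicator_of_mem hn.1 hn.2, mul_one]
    · rw [sosIndicator_apply n, if_neg hn, mul_zero]
      exact sosIndicator_nonneg _
  · rw [sosIndicator_apply m, if_neg hm, zero_mul]
    exact sosIndicator_nonneg _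

lemma isMultiplicative_sosIndicator : sosIndicator.IsMultiplicative := by
  rw [IsMultiplicative.iff_ne_zero]
  refine ⟨sosIndicator_of_mem one_ne_zero one_mem_SOS, fun {m n} hm hn h => ?_⟩
  have hmn := mul_mem_SOS_iff_of_coprime hm hn h
  by_cases h1 : m ∈ SOS <;> by_cases h2 : n ∈ SOS <;>
    simp [sosIndicator_apply, hm, hn, hmn, h1, h2]

/-- Each representation of `n` as a norm from `ℤ[i]`, up to units, yields a factorization of `n`
into two sums of two squares. -/
lemma chiFour_mul_zeta_le (n : ℕ) :
    (chiFour * (ζ : ArithmeticFunction ℝ)) n ≤ (sosIndicator * sosIndicator) n := by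
  obtain rfl | hn := eq_or_ne n 0
  · simp
  have hpp : ∀ p k : ℕ, p.Prime → 0 ≤ (chiFour * (ζ : ArithmeticFunction ℝ)) (p ^ k) ∧
      (chiFour * (ζ : ArithmeticFunction ℝ)) (p ^ k) ≤ (sosIndicator * sosIndicator) (p ^ k) := by
    intro p k hp
    have hpos : ∀ j, p ^ j ≠ 0 := fun j => pow_ne_zero _ hp.ne_zero
    rw [coe_mul_zeta_apply, Nat.sum_divisors_prime_pow hp, mul_apply,
      Nat.sum_divisorsAntidiagonal (fun a b => sosIndicator a * sosIndicator b),
      Nat.sum_divisors_prime_pow hp]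
    simp only [chiFour_pow]
    by_cases hp4 : p % 4 = 3
    · have : chiFour p = -1 := by
        rw [chiFour_apply, if_neg (by omega), if_neg (by omega)]
      rw [this, neg_one_geom_sum]
      rcases Nat.even_or_odd k with hk | hk
      · rw [if_neg (by simpa [Nat.even_add_one] using hk)]
        refine ⟨zero_le_one, ?_⟩
        have hk' : p ^ k ∈ SOS := by
          obtain ⟨j, rfl⟩ := hk
          rw [← two_mul, pow_mul']
          exact sq_mem_SOS _
        calc (1 : ℝ) = sosIndicator (p ^ k) * sosIndicator (p ^ k / p ^ k) := by
              rw [Nat.div_self (Nat.pos_of_ne_zero (hpos k)), sosIndicator_of_mem (hpos k) hk',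
                sosIndicator_of_mem one_ne_zero one_mem_SOS, mul_one]
          _ ≤ _ := single_le_sum
            (f := fun i => sosIndicator (p ^ i) * sosIndicator (p ^ k / p ^ i))
            (fun i _ => mul_nonneg (sosIndicator_nonneg _) (sosIndicator_nonneg _)) (by simp)
      · rw [if_pos (by simpa [Nat.even_add_one] using hk)]
        exact ⟨le_rfl, sum_nonneg fun i _ =>
          mul_nonneg (sosIndicator_nonneg _) (sosIndicator_nonneg _)⟩
    · have hp01 : 0 ≤ chiFour p ∧ chiFour p ≤ 1 := by
        rw [chiFour_apply]
        split_ifs <;> first | omega | norm_num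
      refine ⟨sum_nonneg fun i _ => pow_nonneg hp01.1 i, sum_le_sum fun i hi => ?_⟩
      rw [Nat.pow_div (by simpa [Nat.lt_succ_iff] using hi) hp.pos,
        sosIndicator_of_mem (hpos _) (pow_mem_SOS (prime_mem_SOS hp hp4) _),
        sosIndicator_of_mem (hpos _) (pow_mem_SOS (prime_mem_SOS hp hp4) _), mul_one]
      exact pow_le_one₀ hp01.1 hp01.2
  rw [
    (isMultiplicative_chiFour.mul isMultiplicative_zeta.natCast).multiplicative_factorization _ hn,
    (isMultiplicative_sosIndicator.mul
      isMultiplicative_sosIndicator).multiplicative_factorization _ hn]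
  exact prod_le_prod (fun p hp => (hpp p _ (Nat.prime_of_mem_primeFactors hp)).1)
    fun p hp => (hpp p _ (Nat.prime_of_mem_primeFactors hp)).2

/-- The pointwise quotient of an arithmetic function by the identity. -/
def divId (f : ArithmeticFunction ℝ) : ArithmeticFunction ℝ := ⟨fun n => f n / n, by simp⟩

lemma divId_apply (f : ArithmeticFunction ℝ) (n : ℕ) : divId f n = f n / n := rfl

lemma divId_mul_apply (f g : ArithmeticFunction ℝ) (n : ℕ) :
    (divId f * divId g) n = (f * g) n / n := by
  rw [mul_apply, mul_apply, sum_div]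
  refine sum_congr rfl fun x hx => ?_
  rw [divId_apply, divId_apply, ← (Nat.mem_divisorsAntidiagonal.1 hx).1]
  push_cast
  ring

lemma sum_divId_zeta (N : ℕ) :
    ∑ n ∈ Ioc 0 N, divId (ζ : ArithmeticFunction ℝ) n = (harmonic N : ℝ) := by
  rw [harmonic_eq_sum_Icc, Rat.cast_sum]
  refine sum_congr (by ext; simp; omega) fun n hn => ?_
  rw [mem_Icc] at hn
  rw [divId_apply, natCoe_apply, zeta_apply_ne (by omega)]
  simp

lemma harmonic_mono {m n : ℕ} (h : m ≤ n) : (harmonic m : ℝ) ≤ harmonic n := by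
  rw [← sum_divId_zeta, ← sum_divId_zeta]
  refine sum_le_sum_of_subset_of_nonneg (Ioc_subset_Ioc_right h) fun i _ _ => ?_
  rw [divId_apply, natCoe_apply]
  positivity

lemma harmonic_cast_nonneg (n : ℕ) : (0 : ℝ) ≤ harmonic n := by
  simpa using harmonic_mono (Nat.zero_le n)

lemma log_le_harmonic (N : ℕ) : Real.log N ≤ harmonic N := by
  obtain rfl | hN := Nat.eq_zero_or_pos N
  · simp
  refine le_trans ?_ (log_add_one_le_harmonic N)
  exact Real.log_le_log (by exact_mod_cast hN) (by push_cast; linarith)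

lemma sum_chiFour_mul_ge {g : ℕ → ℝ} {N : ℕ} (h0 : g 0 = 0) (hN : ∀ n, N < n → g n = 0)
    (hg : ∀ a b, 0 < a → a ≤ b → g b ≤ g a) :
    g 1 - g 3 ≤ ∑ d ∈ Ioc 0 N, chiFour d * g d := by
  have h1 : ∑ d ∈ Ioc 0 N, chiFour d * g d = ∑ d ∈ range (4 * (N + 1)), chiFour d * g d := by
    refine sum_subset (fun d hd => ?_) fun d _ hd => ?_
    · rw [mem_Ioc] at hd
      rw [mem_range]
      omega
    · rw [mem_Ioc] at hd
      obtain rfl | hd0 := Nat.eq_zero_or_pos d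
      · rw [h0, mul_zero]
      · rw [hN d (by omega), mul_zero]
  rw [h1, sum_chiFour_range]
  exact single_le_sum (f := fun j => g (4 * j + 1) - g (4 * j + 3))
    (fun j _ => sub_nonneg.2 (hg _ _ (by omega) (by omega))) (by simp : 0 ∈ range (N + 1))

lemma sum_chiFour_mul_zeta_div_ge (N : ℕ) :
    1 / 2 * Real.log N ≤
      ∑ n ∈ Ioc 0 N, (divId chiFour * divId (ζ : ArithmeticFunction ℝ)) n := by
  have h1 := sum_chiFour_mul_ge (g := fun d => (harmonic (N / d) : ℝ) / d) (N := N)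
    (by simp) (fun n hn => by simp [Nat.div_eq_of_lt hn]) fun a b ha hab => by
      have : (0 : ℝ) < a := by exact_mod_cast ha
      have hab' : (a : ℝ) ≤ b := by exact_mod_cast hab
      exact div_le_div₀ (harmonic_cast_nonneg _) (harmonic_mono (Nat.div_le_div_left hab ha))
        this hab'
  have h2 : ∑ n ∈ Ioc 0 N, (divId chiFour * divId (ζ : ArithmeticFunction ℝ)) n =
      ∑ d ∈ Ioc 0 N, chiFour d * ((harmonic (N / d) : ℝ) / d) := by
    rw [sum_Ioc_mul_eq_sum_sum]
    refine sum_congr rfl fun d _ => ?_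
    rw [sum_divId_zeta, divId_apply]
    ring
  have h3 := harmonic_mono (Nat.div_le_self N 3)
  have h4 := log_le_harmonic N
  have h5 := harmonic_cast_nonneg N
  rw [h2]
  refine le_trans ?_ h1
  rw [Nat.div_one, Nat.cast_one, div_one]
  push_cast
  linarith

lemma half_log_le_sq_sum_divId_sosIndicator (N : ℕ) :
    1 / 2 * Real.log N ≤ (∑ n ∈ Ioc 0 N, divId sosIndicator n) ^ 2 := by
  have hsos : ∀ n, 0 ≤ divId sosIndicator n := fun n =>
    div_nonneg (sosIndicator_nonneg n) (Nat.cast_nonneg n)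
  calc 1 / 2 * Real.log N
      ≤ ∑ n ∈ Ioc 0 N, (divId chiFour * divId (ζ : ArithmeticFunction ℝ)) n :=
        sum_chiFour_mul_zeta_div_ge N
    _ ≤ ∑ n ∈ Ioc 0 N, (divId sosIndicator * divId sosIndicator) n := by
        refine sum_le_sum fun n _ => ?_
        rw [divId_mul_apply, divId_mul_apply]
        gcongr
        exact chiFour_mul_zeta_le n
    _ ≤ (∑ n ∈ Ioc 0 N, divId sosIndicator n) ^ 2 := by
        rw [sum_Ioc_mul_eq_sum_sum, pow_two, sum_mul]
        refine sum_le_sum fun n _ => mul_le_mul_of_nonneg_left ?_ (hsos n)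
        exact sum_le_sum_of_subset_of_nonneg (Ioc_subset_Ioc_right (Nat.div_le_self _ _))
          fun i _ _ => hsos i

lemma sum_sosIndicator_mul_vonMangoldtOne_le (X : ℕ) :
    ∑ n ∈ Ioc 0 X, (sosIndicator * vonMangoldtOne) n ≤
      (∑ n ∈ Ioc 0 X, sosIndicator n) * Real.log X := by
  rw [sum_mul]
  refine sum_le_sum fun n hn => ?_
  rw [mem_Ioc] at hn
  calc (sosIndicator * vonMangoldtOne) n
      ≤ ∑ x ∈ n.divisorsAntidiagonal, sosIndicator n * Λ x.2 := by
        rw [mul_apply]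
        refine sum_le_sum fun x hx => ?_
        have hL : 0 ≤ Λ x.2 := vonMangoldt_nonneg
        rw [vonMangoldtOne_apply]
        split_ifs with h
        · obtain h0 | h0 := eq_or_ne (Λ x.2) 0
          · simp [h0]
          · have hpp := vonMangoldt_ne_zero_iff.1 h0
            have h1 := sosIndicator_mul_le x.1 x.2
            rw [(Nat.mem_divisorsAntidiagonal.1 hx).1,
              sosIndicator_of_mem hpp.ne_zero (isPrimePow_mem_SOS hpp h), mul_one] at h1
            gcongr
        · rw [mul_zero]
          exact mul_nonneg (sosIndicator_nonneg n) hL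
    _ = sosIndicator n * Real.log n := by
        rw [← vonMangoldt_sum, mul_sum,
          Nat.sum_divisorsAntidiagonal' (fun _ b => sosIndicator n * Λ b)]
    _ ≤ sosIndicator n * Real.log X := by
        refine mul_le_mul_of_nonneg_left ?_ (sosIndicator_nonneg n)
        exact Real.log_le_log (by exact_mod_cast hn.1) (by exact_mod_cast hn.2)

/-- The lower bound in Landau's theorem on sums of two squares. -/
lemma exists_sum_sosIndicator_ge :
    ∃ c : ℝ, 0 < c ∧ ∀ᶠ X : ℕ in atTop,
      c * X / √(Real.log X) ≤ ∑ n ∈ Ioc 0 X, sosIndicator n := by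
  obtain ⟨C, hC⟩ := exists_sum_vonMangoldtOne_ge
  have hC0 : 0 ≤ C := by simpa using hC 0
  refine ⟨1 / 80, by norm_num, ?_⟩
  have hlog : Tendsto (fun X : ℕ => Real.log X) atTop atTop :=
    Real.tendsto_log_atTop.comp tendsto_natCast_atTop_atTop
  filter_upwards [hlog.eventually_ge_atTop (C + 1)] with X hX
  have hlogpos : 0 < Real.log X := by linarith
  set N := ∑ n ∈ Ioc 0 X, sosIndicator n with hN
  set L := ∑ n ∈ Ioc 0 X, divId sosIndicator n with hL
  have hL0 : 0 ≤ L := sum_nonneg fun n _ => div_nonneg (sosIndicator_nonneg n) (Nat.cast_nonneg n)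
  have hN0 : 0 ≤ N := sum_nonneg fun n _ => sosIndicator_nonneg n
  have h1 : X / 20 * L - (C + 1) * N ≤ ∑ n ∈ Ioc 0 X, (sosIndicator * vonMangoldtOne) n := by
    rw [sum_Ioc_mul_eq_sum_sum, hL, hN, mul_sum, mul_sum, ← sum_sub_distrib]
    refine sum_le_sum fun n hn => ?_
    rw [divId_apply]
    have h2 := hC (X / n)
    have h3 : (X : ℝ) / n ≤ ((X / n : ℕ) : ℝ) + 1 := by
      rw [← Nat.floor_div_eq_div (K := ℝ)]
      exact (Nat.lt_floor_add_one _).le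
    calc X / 20 * (sosIndicator n / n) - (C + 1) * sosIndicator n
        = sosIndicator n * ((X : ℝ) / n / 20 - (C + 1)) := by ring
      _ ≤ _ := mul_le_mul_of_nonneg_left (by linarith) (sosIndicator_nonneg n)
  have h2 := sum_sosIndicator_mul_vonMangoldtOne_le X
  have h3 := half_log_le_sq_sum_divId_sosIndicator X
  rw [← hL] at h3
  set s := √(Real.log X) with hs
  have hspos : 0 < s := Real.sqrt_pos.2 hlogpos
  have hss : s * s = Real.log X := Real.mul_self_sqrt hlogpos.le
  have h4 : 1 / 2 * s ≤ L := by
    apply le_of_sq_le_sq _ hL0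
    nlinarith
  have h5 : X / 20 * L ≤ 2 * N * Real.log X := by
    have : (C + 1) * N ≤ N * Real.log X := by rw [mul_comm]; gcongr
    linarith
  rw [div_le_iff₀ hspos]
  have h6 : (X : ℝ) / 20 * (1 / 2 * s) ≤ 2 * N * (s * s) := by
    rw [hss]
    exact le_trans (by gcongr) h5
  have h7 : (X : ℝ) / 40 ≤ 2 * N * s := by
    refine le_of_mul_le_mul_right ?_ hspos
    linarith
  linarith

open Classical in
lemma betweenCount_eq_card (m n : ℕ) :
    betweenCount m n = #{k ∈ Ioo (min m n) (max m n) | k ∈ SOS} := by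
  refine Nat.subtype_card _ fun k => ?_
  simp only [mem_filter, mem_Ioo]
  tauto

lemma betweenCount_lt_of_lt {a b n : ℕ} (hb : b ∈ SOS) (hab : a < b) (hbn : b < n) :
    betweenCount b n < betweenCount a n := by
  classical
  rw [betweenCount_eq_card, betweenCount_eq_card, min_eq_left hbn.le, max_eq_right hbn.le,
    min_eq_left (hab.trans hbn).le, max_eq_right (hab.trans hbn).le]
  refine card_lt_card ((ssubset_iff_of_subset fun k hk => ?_).2 ⟨b, ?_, ?_⟩)
  · simp only [mem_filter, mem_Ioo] at hk ⊢
    exact ⟨⟨hab.trans hk.1.1, hk.1.2⟩, hk.2⟩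
  · simp [hb, hab, hbn]
  · simp

lemma betweenCount_lt_of_gt {a b n : ℕ} (ha : a ∈ SOS) (hna : n < a) (hab : a < b) :
    betweenCount a n < betweenCount b n := by
  classical
  rw [betweenCount_eq_card, betweenCount_eq_card, min_eq_right hna.le, max_eq_left hna.le,
    min_eq_right (hna.trans hab).le, max_eq_left (hna.trans hab).le]
  refine card_lt_card ((ssubset_iff_of_subset fun k hk => ?_).2 ⟨a, ?_, ?_⟩)
  · simp only [mem_filter, mem_Ioo] at hk ⊢
    exact ⟨⟨hk.1.1, hk.1.2.trans hab⟩, hk.2⟩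
  · simp [ha, hab, hna]
  · simp

/-- At most `2 * c + 1` sums of two squares are fewer than `c` steps away from `n`. -/
lemma card_le_of_betweenCount_lt {n c : ℕ} {A : Finset ℕ} (hA : ∀ m ∈ A, m ∈ SOS)
    (h : ∀ m ∈ A, betweenCount m n < c) : #A ≤ 2 * c + 1 := by
  have h1 : #{m ∈ A | m < n} ≤ c := by
    rw [← card_range c]
    refine card_le_card_of_injOn (betweenCount · n) (fun m hm => ?_) fun a ha b hb hab => ?_
    · simp only [coe_filter, Set.mem_ofPred_eq] at hm
      simpa using h m hm.1
    · simp only [coe_filter, Set.mem_ofPred_eq] at ha hb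
      rcases lt_trichotomy a b with hlt | heq | hlt
      · exact absurd hab (betweenCount_lt_of_lt (hA b hb.1) hlt hb.2).ne'
      · exact heq
      · exact absurd hab (betweenCount_lt_of_lt (hA a ha.1) hlt ha.2).ne
  have h2 : #{m ∈ A | n < m} ≤ c := by
    rw [← card_range c]
    refine card_le_card_of_injOn (betweenCount · n) (fun m hm => ?_) fun a ha b hb hab => ?_
    · simp only [coe_filter, Set.mem_ofPred_eq] at hm
      simpa using h m hm.1
    · simp only [coe_filter, Set.mem_ofPred_eq] at ha hb
      rcases lt_trichotomy a b with hlt | heq | hlt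
      · exact absurd hab (betweenCount_lt_of_gt (hA a ha.1) ha.2 hlt).ne
      · exact heq
      · exact absurd hab (betweenCount_lt_of_gt (hA b hb.1) hb.2 hlt).ne'
  have h3 : A ⊆ ({m ∈ A | m < n} ∪ {m ∈ A | n < m}) ∪ {n} := fun m hm => by
    simp only [mem_union, mem_filter, mem_singleton, hm, true_and]
    omega
  calc #A ≤ _ := card_le_card h3
    _ ≤ _ := card_union_le _ _
    _ ≤ _ := add_le_add_left (card_union_le _ _) _
    _ ≤ 2 * c + 1 := by rw [card_singleton]; omega

lemma sqrt_le_two_mul_betweenCount {m n : ℕ} (h : 4 * m < n) :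
    Nat.sqrt (n - 1) ≤ 2 * betweenCount m n := by
  classical
  have hmn : m < n := by omega
  have h1 : 2 * Nat.sqrt m ≤ Nat.sqrt (n - 1) := by
    rw [Nat.le_sqrt]
    have := Nat.sqrt_le m
    nlinarith [Nat.le_sub_one_of_lt h]
  have h2 : Nat.sqrt (n - 1) - Nat.sqrt m ≤ betweenCount m n := by
    rw [betweenCount_eq_card, min_eq_left hmn.le, max_eq_right hmn.le,
      ← Nat.card_Ioc (Nat.sqrt m) (Nat.sqrt (n - 1))]
    refine card_le_card_of_injOn (· ^ 2) (fun k hk => ?_)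
      fun a _ b _ hab => Nat.pow_left_injective two_ne_zero hab
    simp only [coe_Ioc, Set.mem_Ioc, Nat.sqrt_lt', Nat.le_sqrt'] at hk
    simp only [coe_filter, mem_Ioo, Set.mem_ofPred_eq]
    exact ⟨⟨hk.1, by omega⟩, sq_mem_SOS k⟩
  omega

lemma sum_r2_le (Y : ℕ) : ∑ n ∈ range (Y + 1), r2 n ≤ (2 * Nat.sqrt Y + 1) ^ 2 := by
  set s : ℤ := ((Nat.sqrt Y : ℕ) : ℤ) with hs
  set box : Finset (ℤ × ℤ) := Icc (-s) s ×ˢ Icc (-s) s with hbox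
  have hcard : #box = (2 * Nat.sqrt Y + 1) ^ 2 := by
    rw [hbox, card_product, Int.card_Icc, pow_two]
    congr 1 <;> omega
  have habs : ∀ x y : ℤ, ∀ n : ℕ, n ≤ Y → x ^ 2 + y ^ 2 = n → x ∈ Icc (-s) s := by
    intro x y n hn hxy
    have h1 : x.natAbs ^ 2 ≤ Y := by
      zify
      rw [sq_abs]
      have : (n : ℤ) ≤ Y := by exact_mod_cast hn
      nlinarith [sq_nonneg y]
    have h2 : x.natAbs ≤ Nat.sqrt Y := Nat.le_sqrt'.2 h1
    rw [mem_Icc]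
    omega
  have hr : ∀ n ∈ range (Y + 1), r2 n = #{p ∈ box | (p.1 ^ 2 + p.2 ^ 2).toNat = n} := by
    intro n hn
    rw [r2, Nat.subtype_card]
    rintro ⟨x, y⟩
    rw [mem_filter, hbox, mem_product]
    have hn' : n ≤ Y := by rw [mem_range] at hn; omega
    have : 0 ≤ x ^ 2 + y ^ 2 := by positivity
    constructor
    · rintro ⟨-, h⟩
      dsimp only at h ⊢
      omega
    · intro h
      dsimp only at h ⊢
      exact ⟨⟨habs x y n hn' h, habs y x n hn' (by rw [add_comm]; exact h)⟩, by omega⟩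
  rw [sum_congr rfl hr, ← hcard, sum_card_fiberwise_eq_card_filter]
  exact card_filter_le _ _

/-- The numbers `n` whose number of representations is in the medium range. -/
def IsMedium (n : ℕ) : Prop :=
  n ∈ SOS ∧ Real.log n ^ (1 / 2 : ℝ) * Real.log (Real.log n) ≤ (r2 n : ℝ) ∧
    (r2 n : ℝ) ≤ Real.log n ^ 2

/-- The required separation from a number `n` in the medium range. -/
def separation (n : ℕ) : ℝ :=
  (r2 n : ℝ) / (Real.log n ^ (1 / 2 : ℝ) * Real.log (Real.log n) * Real.log (r2 n) ^ 2)

lemma three_le_sqrt_mul_log {T : ℝ} (hT : 9 ≤ T) : 3 ≤ √T * Real.log T := by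
  have h1 : 3 ≤ √T := by rw [Real.le_sqrt' (by norm_num)]; linarith
  have h2 : 1 ≤ Real.log T := by
    rw [Real.le_log_iff_exp_le (by linarith)]
    linarith [Real.exp_one_lt_d9]
  nlinarith

lemma IsMedium.separation_le {n : ℕ} (h : IsMedium n) {T : ℝ} (hT : 9 ≤ T)
    (hTn : T ≤ Real.log n) :
    √T * Real.log T ≤ r2 n ∧ separation n ≤ r2 n / (√T * Real.log T) := by
  have h3 := three_le_sqrt_mul_log hT
  have hmono : √T * Real.log T ≤ √(Real.log n) * Real.log (Real.log n) := by
    have : 0 ≤ Real.log T := Real.log_nonneg (by linarith)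
    gcongr
  obtain ⟨-, hlow, -⟩ := h
  rw [separation, ← Real.sqrt_eq_rpow]
  rw [← Real.sqrt_eq_rpow] at hlow
  refine ⟨hmono.trans hlow, ?_⟩
  have hlog : 1 ≤ Real.log (r2 n) := by
    rw [Real.le_log_iff_exp_le (by linarith)]
    linarith [Real.exp_one_lt_d9]
  refine div_le_div_of_nonneg_left (Nat.cast_nonneg _) (by linarith) ?_
  exact hmono.trans (le_mul_of_one_le_right (by linarith) (one_le_pow₀ hlog))

lemma IsMedium.separation_le_sq_log {n : ℕ} (h : IsMedium n) (hn : 9 ≤ Real.log n) :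
    separation n ≤ Real.log n ^ 2 := by
  have h3 := three_le_sqrt_mul_log hn
  refine ((h.separation_le hn le_rfl).2.trans ?_).trans h.2.2
  exact div_le_self (Nat.cast_nonneg _) (by linarith)

lemma eventually_separation_le_betweenCount :
    ∀ᶠ n : ℕ in atTop, 9 ≤ Real.log n ∧
      ∀ m, IsMedium n → 4 * m < n → separation n ≤ betweenCount m n := by
  have hev : ∀ᶠ x : ℝ in atTop, 9 ≤ Real.log x ∧ 2 * Real.log x ^ 2 + 1 ≤ √x := by
    have := (isLittleO_log_rpow_atTop (r := 1 / 4) (by norm_num)).bound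
      (c := 1 / 2) (by norm_num)
    filter_upwards [this, Real.tendsto_log_atTop.eventually_ge_atTop 9,
      eventually_ge_atTop 4] with x hx h9 h4
    refine ⟨h9, ?_⟩
    rw [Real.norm_of_nonneg (by linarith), Real.norm_of_nonneg (by positivity)] at hx
    have hsq : (x ^ (1 / 4 : ℝ)) ^ 2 = √x := by
      rw [← Real.rpow_natCast, ← Real.rpow_mul (by linarith), Real.sqrt_eq_rpow]
      norm_num
    have h2 : 2 ≤ √x := by rw [Real.le_sqrt' (by norm_num)]; linarith
    have h5 : Real.log x ^ 2 ≤ (1 / 2 * x ^ (1 / 4 : ℝ)) ^ 2 := by gcongr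
    rw [mul_pow, hsq] at h5
    linarith
  filter_upwards [tendsto_natCast_atTop_atTop.eventually hev] with n hn
  refine ⟨hn.1, fun m hm hmn => ?_⟩
  have h1 := hm.separation_le_sq_log hn.1
  have h2 : (Nat.sqrt (n - 1) : ℝ) ≤ 2 * betweenCount m n := by
    exact_mod_cast sqrt_le_two_mul_betweenCount hmn
  have h3 : √(n : ℝ) ≤ Nat.sqrt (n - 1) + 1 := by
    rw [Real.sqrt_le_left (by positivity)]
    have := Nat.lt_succ_sqrt' (n - 1)
    have : n ≤ (Nat.sqrt (n - 1) + 1) ^ 2 := by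
      rw [Nat.succ_eq_add_one] at this
      omega
    exact_mod_cast this
  linarith [hn.2]

/-- The numbers that are too close to some number in the medium range. -/
def exceptionalSet : Set ℕ :=
  {m | m ∈ SOS ∧ ∃ n, IsMedium n ∧ (betweenCount m n : ℝ) < separation n}

open Classical in
lemma exists_card_exceptionalSet_le :
    ∃ C : ℝ, ∀ᶠ x : ℕ in atTop, (#{m ∈ range (x + 1) | m ∈ exceptionalSet} : ℝ) ≤
      C + (√((4 * x : ℕ) : ℝ) + 1) * (2 * Real.log (4 * x : ℕ) ^ 2 + 3) +
        45 * ((4 * x : ℕ) : ℝ) /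
          (√(Real.log (4 * x : ℕ) / 2) * Real.log (Real.log (4 * x : ℕ) / 2)) := by
  obtain ⟨n₀, hn₀⟩ := eventually_atTop.1 eventually_separation_le_betweenCount
  refine ⟨∑ n ∈ range n₀, (2 * (⌈separation n⌉₊ : ℝ) + 1), ?_⟩
  have hlog : Tendsto (fun x : ℕ => Real.log x) atTop atTop :=
    Real.tendsto_log_atTop.comp tendsto_natCast_atTop_atTop
  filter_upwards [hlog.eventually_ge_atTop 18, eventually_ge_atTop 1] with x hx hx1
  set Y := 4 * x with hY
  have hY1 : (1 : ℝ) ≤ Y := by exact_mod_cast (by omega : 1 ≤ Y)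
  have hlogY : 18 ≤ Real.log Y := by
    refine hx.trans (Real.log_le_log (by exact_mod_cast hx1) ?_)
    exact_mod_cast (by omega : x ≤ Y)
  set D := √(Real.log Y / 2) * Real.log (Real.log Y / 2) with hD
  have hD3 : 3 ≤ D := three_le_sqrt_mul_log (by linarith)
  set A : ℕ → Finset ℕ := fun n =>
    {m ∈ range (x + 1) | m ∈ SOS ∧ betweenCount m n < ⌈separation n⌉₊} with hA
  have hAcard : ∀ n, (#(A n) : ℝ) ≤ 2 * (⌈separation n⌉₊ : ℝ) + 1 := fun n => by
    exact_mod_cast card_le_of_betweenCount_lt (n := n) (A := A n)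
      (fun m hm => (mem_filter.1 hm).2.1) fun m hm => (mem_filter.1 hm).2.2
  have hAcard' : ∀ n, 0 ≤ separation n → (#(A n) : ℝ) ≤ 2 * separation n + 3 := fun n hn => by
    linarith [hAcard n, Nat.ceil_lt_add_one hn]
  set M₁ : Finset ℕ := {n ∈ range (Nat.sqrt Y + 1) | n₀ ≤ n ∧ 0 < separation n ∧ IsMedium n}
    with hM₁
  set M₂ : Finset ℕ := {n ∈ range (Y + 1) | Y ≤ n ^ 2 ∧ 0 < separation n ∧ IsMedium n} with hM₂
  have hsub : {m ∈ range (x + 1) | m ∈ exceptionalSet} ⊆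
      (range n₀).biUnion A ∪ (M₁.biUnion A ∪ M₂.biUnion A) := by
    intro m hm
    obtain ⟨hmx, hmS, n, hn, hlt⟩ := mem_filter.1 hm
    have hmA : m ∈ A n := mem_filter.2 ⟨hmx, hmS, Nat.lt_ceil.2 hlt⟩
    have hpos : 0 < separation n := (Nat.cast_nonneg _).trans_lt hlt
    rw [mem_range] at hmx
    rcases lt_or_ge n n₀ with h | h
    · exact mem_union_left _ (mem_biUnion.2 ⟨n, mem_range.2 h, hmA⟩)
    · have hnY : n ≤ Y := by
        by_contra! hc
        exact absurd ((hn₀ n h).2 m hn (by omega)) (not_le.2 hlt)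
      refine mem_union_right _ ?_
      rcases le_or_gt Y (n ^ 2) with h' | h'
      · exact mem_union_right _ (mem_biUnion.2
          ⟨n, mem_filter.2 ⟨mem_range.2 (by omega), h', hpos, hn⟩, hmA⟩)
      · have : n ≤ Nat.sqrt Y := Nat.le_sqrt'.2 h'.le
        exact mem_union_left _ (mem_biUnion.2
          ⟨n, mem_filter.2 ⟨mem_range.2 (by omega), h, hpos, hn⟩, hmA⟩)
  have hb0 : (#((range n₀).biUnion A) : ℝ) ≤
      ∑ n ∈ range n₀, (2 * (⌈separation n⌉₊ : ℝ) + 1) := by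
    refine (Nat.cast_le.2 card_biUnion_le).trans ?_
    push_cast
    exact sum_le_sum fun n _ => hAcard n
  have hsqrtY : (Nat.sqrt Y : ℝ) ≤ √(Y : ℝ) := Real.nat_sqrt_le_real_sqrt
  have hb1 : (#(M₁.biUnion A) : ℝ) ≤ (√(Y : ℝ) + 1) * (2 * Real.log Y ^ 2 + 3) := by
    have h1 : (#(M₁.biUnion A) : ℝ) ≤ ∑ n ∈ M₁, (2 * Real.log Y ^ 2 + 3) := by
      refine (Nat.cast_le.2 card_biUnion_le).trans ?_
      push_cast
      refine sum_le_sum fun n hn => ?_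
      obtain ⟨hn1, hn2, hn3, hn4⟩ := mem_filter.1 hn
      have h9 := (hn₀ n hn2).1
      have hle := hn4.separation_le_sq_log h9
      have hnY : n ≤ Y := by
        have := Nat.sqrt_le_self Y
        rw [mem_range] at hn1
        omega
      have hlogle : Real.log n ≤ Real.log Y := by
        obtain rfl | hn0 := Nat.eq_zero_or_pos n
        · simp at h9
          linarith
        · exact Real.log_le_log (by exact_mod_cast hn0) (by exact_mod_cast hnY)
      have : Real.log n ^ 2 ≤ Real.log Y ^ 2 := by gcongr
      linarith [hAcard' n hn3.le]
    refine h1.trans ?_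
    rw [sum_const, nsmul_eq_mul]
    have h2 : (#M₁ : ℝ) ≤ Nat.sqrt Y + 1 := by
      exact_mod_cast (card_filter_le _ _).trans (card_range _).le
    gcongr
    linarith
  have hb2 : (#(M₂.biUnion A) : ℝ) ≤ 45 * (Y : ℝ) / D := by
    have h1 : (#(M₂.biUnion A) : ℝ) ≤ ∑ n ∈ M₂, 5 / D * (r2 n : ℝ) := by
      refine (Nat.cast_le.2 card_biUnion_le).trans ?_
      push_cast
      refine sum_le_sum fun n hn => ?_
      obtain ⟨hn1, hn2, hn3, hn4⟩ := mem_filter.1 hn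
      have hlogn : Real.log Y / 2 ≤ Real.log n := by
        have : Real.log Y ≤ Real.log ((n : ℝ) ^ 2) :=
          Real.log_le_log (by linarith) (by exact_mod_cast hn2)
        rw [Real.log_pow] at this
        push_cast at this
        linarith
      obtain ⟨h3, h4⟩ := hn4.separation_le (by linarith : 9 ≤ Real.log Y / 2) hlogn
      have h5 : 1 ≤ (r2 n : ℝ) / D := by rw [le_div_iff₀ (by linarith)]; linarith
      calc (#(A n) : ℝ) ≤ 2 * ((r2 n : ℝ) / D) + 3 * ((r2 n : ℝ) / D) := by
            linarith [hAcard' n hn3.le]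
        _ = 5 / D * (r2 n : ℝ) := by ring
    have h2 : ∑ n ∈ M₂, (r2 n : ℝ) ≤ 9 * Y := by
      calc ∑ n ∈ M₂, (r2 n : ℝ) ≤ ∑ n ∈ range (Y + 1), (r2 n : ℝ) :=
            sum_le_sum_of_subset_of_nonneg (filter_subset _ _) fun _ _ _ => Nat.cast_nonneg _
        _ ≤ (2 * Nat.sqrt Y + 1 : ℝ) ^ 2 := by exact_mod_cast sum_r2_le Y
        _ ≤ (3 * √(Y : ℝ)) ^ 2 := by
            have : 1 ≤ √(Y : ℝ) := Real.one_le_sqrt.2 hY1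
            gcongr
            linarith
        _ = 9 * Y := by
            rw [mul_pow, Real.sq_sqrt (by linarith)]
            norm_num
    calc (#(M₂.biUnion A) : ℝ) ≤ 5 / D * ∑ n ∈ M₂, (r2 n : ℝ) := by rwa [mul_sum]
      _ ≤ 5 / D * (9 * Y) := by gcongr
      _ = 45 * (Y : ℝ) / D := by ring
  have hfin : (#{m ∈ range (x + 1) | m ∈ exceptionalSet} : ℝ) ≤
      #((range n₀).biUnion A) + (#(M₁.biUnion A) + #(M₂.biUnion A)) := by
    exact_mod_cast (card_le_card hsub).trans
      ((card_union_le _ _).trans (add_le_add_right (card_union_le _ _) _))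
  linarith

lemma tendsto_exceptional_bound (C c : ℝ) :
    Tendsto (fun y : ℝ => c * (√(Real.log y) / y * (C + (√y + 1) * (2 * Real.log y ^ 2 + 3) +
      45 * y / (√(Real.log y / 2) * Real.log (Real.log y / 2))))) atTop (𝓝 0) := by
  rw [← mul_zero c]
  refine Tendsto.const_mul c ?_
  have hpow : Tendsto (fun y : ℝ => y ^ (-(1 / 4) : ℝ)) atTop (𝓝 0) :=
    tendsto_rpow_neg_atTop (by norm_num)
  have hloglog : Tendsto (fun y : ℝ => Real.log (Real.log y / 2)) atTop atTop :=
    Real.tendsto_log_atTop.comp (Real.tendsto_log_atTop.atTop_div_const (by norm_num))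
  have hbound : Tendsto (fun y : ℝ => (|C| + 10) * y ^ (-(1 / 4) : ℝ) +
      45 * √2 / Real.log (Real.log y / 2)) atTop (𝓝 0) := by
    simpa using (hpow.const_mul (|C| + 10)).add (hloglog.const_div_atTop (45 * √2))
  have hlog := (isLittleO_log_rpow_atTop (r := 1 / 12) (by norm_num)).bound
    (c := 1) (by norm_num)
  refine squeeze_zero_norm' ?_ hbound
  filter_upwards [hlog, Real.tendsto_log_atTop.eventually_ge_atTop 1,
    hloglog.eventually_ge_atTop 1, eventually_ge_atTop 1] with y hy hl1 hll hy1
  have hy0 : 0 < y := by linarith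
  set u := y ^ (1 / 12 : ℝ) with hu
  set l := Real.log y with hl
  have hu0 : 0 < u := Real.rpow_pos_of_pos hy0 _
  have hu1 : 1 ≤ u := Real.one_le_rpow hy1 (by norm_num)
  have hu12 : y = u ^ 12 := by
    rw [hu, ← Real.rpow_natCast, ← Real.rpow_mul hy0.le]
    norm_num
  have hsqrt : √y = u ^ 6 := by
    rw [hu12, show u ^ 12 = (u ^ 6) ^ 2 by ring, Real.sqrt_sq (by positivity)]
  have hneg : y ^ (-(1 / 4) : ℝ) = 1 / u ^ 3 := by
    rw [Real.rpow_neg hy0.le, hu, ← Real.rpow_natCast, ← Real.rpow_mul hy0.le]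
    norm_num
  rw [Real.norm_of_nonneg (by linarith), Real.norm_of_nonneg hu0.le, one_mul] at hy
  have hsl : √l ≤ u := (Real.sqrt_le_left hu0.le).2 (by nlinarith)
  have hsl0 : 0 < √l := Real.sqrt_pos.2 (by linarith)
  have hmain : √l / y * (45 * y / (√(l / 2) * Real.log (l / 2))) =
      45 * √2 / Real.log (l / 2) := by
    rw [Real.sqrt_div' _ (by norm_num)]
    field_simp
  have hrest : √l / y * (|C| + (√y + 1) * (2 * l ^ 2 + 3)) ≤ (|C| + 10) * (1 / u ^ 3) := by
    have h1 : 2 * l ^ 2 + 3 ≤ 5 * u ^ 2 := by nlinarith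
    have h2 : √y + 1 ≤ 2 * u ^ 6 := by
      rw [hsqrt]
      linarith [one_le_pow₀ hu1 (n := 6)]
    have h3 : |C| ≤ |C| * u ^ 8 := le_mul_of_one_le_right (abs_nonneg C) (one_le_pow₀ hu1)
    calc √l / y * (|C| + (√y + 1) * (2 * l ^ 2 + 3))
        ≤ u / y * (|C| * u ^ 8 + (2 * u ^ 6) * (5 * u ^ 2)) := by gcongr
      _ = (|C| + 10) * (1 / u ^ 3) := by
          rw [hu12]
          field_simp
          ring
  have hD : 0 < Real.log (l / 2) := by linarith
  rw [norm_mul, Real.norm_of_nonneg (by positivity : 0 ≤ √l / y), hneg, ← hmain]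
  calc √l / y * ‖C + (√y + 1) * (2 * l ^ 2 + 3) + 45 * y / (√(l / 2) * Real.log (l / 2))‖
      ≤ √l / y * (|C| + (√y + 1) * (2 * l ^ 2 + 3) +
          45 * y / (√(l / 2) * Real.log (l / 2))) := by
        gcongr
        refine (norm_add₃_le).trans (le_of_eq ?_)
        rw [Real.norm_eq_abs C,
          Real.norm_of_nonneg (by positivity : 0 ≤ (√y + 1) * (2 * l ^ 2 + 3)),
          Real.norm_of_nonneg (by positivity)]
    _ ≤ _ := by
        rw [mul_add]
        gcongr

open Classical in
lemma card_subtype_le_eq (S : Set ℕ) (x : ℕ) :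
    Nat.card {m : ℕ // m ∈ S ∧ m ≤ x} = #{m ∈ range (x + 1) | m ∈ S} := by
  refine Nat.subtype_card _ fun m => ?_
  rw [mem_filter, mem_range, Nat.lt_succ_iff, and_comm]

lemma fullDensityIn_diff_exceptionalSet : FullDensityIn (SOS \ exceptionalSet) := by
  classical
  refine ⟨Set.sdiff_subset, ?_⟩
  obtain ⟨c, hc, hlower⟩ := exists_sum_sosIndicator_ge
  obtain ⟨C, hupper⟩ := exists_card_exceptionalSet_le
  have hlim := (tendsto_exceptional_bound C (4 / c)).comp
    (tendsto_natCast_atTop_atTop.comp (tendsto_id.const_mul_atTop' (by norm_num : 0 < 4)))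
  have hbad : Tendsto (fun x : ℕ => (#{m ∈ range (x + 1) | m ∈ exceptionalSet} : ℝ) /
      #{m ∈ range (x + 1) | m ∈ SOS}) atTop (𝓝 0) := by
    refine squeeze_zero' (Eventually.of_forall fun x => by positivity) ?_ hlim
    filter_upwards [hlower, hupper, eventually_ge_atTop 2] with x hlo hup hx
    have hx2 : (2 : ℝ) ≤ x := by exact_mod_cast hx
    have hsum : ∑ n ∈ Ioc 0 x, (sosIndicator n : ℝ) ≤ #{m ∈ range (x + 1) | m ∈ SOS} := by
      simp_rw [sosIndicator_apply]
      rw [sum_boole]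
      refine Nat.cast_le.2 (card_le_card fun m hm => ?_)
      simp only [mem_filter, mem_Ioc, mem_range] at hm ⊢
      exact ⟨by omega, hm.2.2⟩
    have hlogx : 0 < Real.log x := Real.log_pos (by linarith)
    have hle : √(Real.log x) ≤ √(Real.log ((4 * x : ℕ) : ℝ)) := by
      gcongr
      omega
    have hs : 0 < √(Real.log x) := Real.sqrt_pos.2 hlogx
    set B := C + (√((4 * x : ℕ) : ℝ) + 1) * (2 * Real.log (4 * x : ℕ) ^ 2 + 3) +
        45 * ((4 * x : ℕ) : ℝ) /
          (√(Real.log (4 * x : ℕ) / 2) * Real.log (Real.log (4 * x : ℕ) / 2)) with hB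
    have hB0 : 0 ≤ B := (Nat.cast_nonneg _).trans hup
    calc _ ≤ B / (c * x / √(Real.log x)) := by
          gcongr
          exact hlo.trans hsum
      _ = 4 / c * (√(Real.log x) / (4 * x : ℕ) * B) := by
          push_cast
          field_simp
      _ ≤ 4 / c * (√(Real.log ((4 * x : ℕ) : ℝ)) / (4 * x : ℕ) * B) := by gcongr
  have hone := hbad.const_sub 1
  rw [sub_zero] at hone
  refine hone.congr fun x => ?_
  have hpos : (0 : ℝ) < #{m ∈ range (x + 1) | m ∈ SOS} := by
    exact_mod_cast card_pos.2 ⟨0, mem_filter.2 ⟨by simp, zero_mem_SOS⟩⟩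
  have hsplit : #{m ∈ range (x + 1) | m ∈ SOS \ exceptionalSet} +
      #{m ∈ range (x + 1) | m ∈ exceptionalSet} = #{m ∈ range (x + 1) | m ∈ SOS} := by
    rw [← card_union_of_disjoint, ← filter_or]
    · congr 1
      refine filter_congr fun m _ => ?_
      rw [Set.mem_sdiff]
      have : m ∈ exceptionalSet → m ∈ SOS := And.left
      tauto
    · exact disjoint_filter.2 fun m _ h1 h2 => h1.2 h2
  rw [card_subtype_le_eq, card_subtype_le_eq, one_sub_div hpos.ne', ← hsplit]
  push_cast
  rw [add_sub_cancel_right]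
  congr!

end SumsOfTwoSquares

/-- For medium `r₂(n)`, many elements of `𝒩` lie between `m` and `n`,
for `m` in a full density subset of `𝒩`. -/
theorem medium_r2_separation :
    ∃ S : Set ℕ, FullDensityIn S ∧
      ∀ m ∈ S, ∀ n ∈ SOS,
        Real.log n ^ (1 / 2 : ℝ) * Real.log (Real.log n) ≤ (r2 n : ℝ) →
        (r2 n : ℝ) ≤ Real.log n ^ 2 →
        (r2 n : ℝ) /
            (Real.log n ^ (1 / 2 : ℝ) * Real.log (Real.log n) * Real.log (r2 n) ^ 2)
          ≤ (betweenCount m n : ℝ) := by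
  refine ⟨SOS \ exceptionalSet, fullDensityIn_diff_exceptionalSet,
    fun m hm n hn hlow hup => ?_⟩
  by_contra! h
  exact hm.2 ⟨hm.1, n, ⟨hn, hlow, hup⟩, h⟩
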